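/- For every α ∈ [1/2,∞)\{1}, the function √(Δ_α) is a metric on ℙ_d, where Δ_α(X,Y) := S_α(X,M) + S_α(Y,M) with M := ((X^α + Y^α)/2)^{1/α}; i.e., Δ_α(X,Y) ≥ 0 with equality iff X = Y, Δ_α(X,Y) = Δ_α(Y,X), and √(Δ_α(X,Z)) ≤ √(Δ_α(X,Y)) + √(Δ_α(Y,Z)) for all X, Y, Z ∈ ℙ_d. -/

import Mathlib

open Matrix
open scoped ComplexOrder

/-- The matrix power `X^r` of a Hermitian matrix `X`, defined via the spectral
decomposition (functional calculus applied to `x ↦ x^r`). -/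
noncomputable def mpow {d : ℕ} (X : Matrix (Fin d) (Fin d) ℂ) (r : ℝ) :
    Matrix (Fin d) (Fin d) ℂ :=
  if hX : X.IsHermitian then hX.cfc (fun x => x ^ r) else 0

/-- The α-Tsallis relative entropy
`S_α(X,Y) = (α·tr X + (1−α)·tr Y − tr(X^α Y^{1−α}))/(1−α)`. -/
noncomputable def tsallisRel {d : ℕ} (α : ℝ) (X Y : Matrix (Fin d) (Fin d) ℂ) : ℝ :=
  (α * X.trace.re + (1 - α) * Y.trace.re - (mpow X α * mpow Y (1 - α)).trace.re) / (1 - α)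

/-- The power mean `M = ((X^α + Y^α)/2)^{1/α}`. -/
noncomputable def powerMean {d : ℕ} (α : ℝ) (X Y : Matrix (Fin d) (Fin d) ℂ) :
    Matrix (Fin d) (Fin d) ℂ :=
  mpow ((1 / 2 : ℝ) • (mpow X α + mpow Y α)) (1 / α)

/-- The Jensen-Shannon α-Tsallis divergence `Δ_α(X,Y) = S_α(X,M) + S_α(Y,M)` with
`M = ((X^α+Y^α)/2)^{1/α}`. -/
noncomputable def jsTsallis {d : ℕ} (α : ℝ) (X Y : Matrix (Fin d) (Fin d) ℂ) : ℝ :=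
  tsallisRel α X (powerMean α X Y) + tsallisRel α Y (powerMean α X Y)

section LogKernel

open Real Set MeasureTheory

theorem integral_rpow_mul_inv_sub_inv {p : ℝ} (hp0 : 0 < p) (hp2 : p < 2) (hp1 : p ≠ 1) :
    ∃ K : ℝ, 0 < K ∧ ∀ x : ℝ, 0 < x →
      IntegrableOn (fun t : ℝ => t ^ (p - 1) * ((1 + t)⁻¹ - (x + t)⁻¹)) (Ioi 0) ∧
      ∫ t in Ioi (0 : ℝ), t ^ (p - 1) * ((1 + t)⁻¹ - (x + t)⁻¹) =
        K * ((x ^ (p - 1) - 1) / (p - 1)) := by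
  rcases lt_or_gt_of_ne hp1 with h | h
  · have hp : p ∈ Ioo (0 : ℝ) 1 := ⟨hp0, h⟩
    refine ⟨(1 - p) * ∫ t in Ioi (0 : ℝ), rpowIntegrand₀₁ p t 1,
      mul_pos (by linarith) (integral_rpowIntegrand₀₁_one_pos hp), fun x hx => ?_⟩
    have heq : EqOn (fun t : ℝ => t ^ (p - 1) * ((1 + t)⁻¹ - (x + t)⁻¹))
        (fun t => rpowIntegrand₀₁ p t 1 - x⁻¹ * rpowIntegrand₀₁ p t x) (Ioi 0) := by
      intro t ht
      have ht : 0 < t := ht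
      simp only [rpowIntegrand₀₁, rpow_sub_one ht.ne']
      field_simp
      ring
    have hi1 := integrableOn_rpowIntegrand₀₁_Ioi hp zero_le_one
    have hix := (integrableOn_rpowIntegrand₀₁_Ioi hp hx.le).const_mul x⁻¹
    refine ⟨(integrableOn_congr_fun heq measurableSet_Ioi).2 (hi1.sub hix), ?_⟩
    rw [setIntegral_congr_fun measurableSet_Ioi heq, integral_sub hi1 hix, integral_const_mul,
      integral_rpowIntegrand₀₁_eq_rpow_mul_const hp hx.le, rpow_sub_one hx.ne']
    have : p - 1 ≠ 0 := by linarith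
    field_simp
    ring
  · have hp : p - 1 ∈ Ioo (0 : ℝ) 1 := ⟨by linarith, by linarith⟩
    refine ⟨(p - 1) * ∫ t in Ioi (0 : ℝ), rpowIntegrand₀₁ (p - 1) t 1,
      mul_pos hp.1 (integral_rpowIntegrand₀₁_one_pos hp), fun x hx => ?_⟩
    have heq : EqOn (fun t : ℝ => t ^ (p - 1) * ((1 + t)⁻¹ - (x + t)⁻¹))
        (fun t => rpowIntegrand₀₁ (p - 1) t x - rpowIntegrand₀₁ (p - 1) t 1) (Ioi 0) := by
      intro t ht
      simp only [rpowIntegrand₀₁, add_comm t]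
      ring
    have hi1 := integrableOn_rpowIntegrand₀₁_Ioi hp zero_le_one
    have hix := integrableOn_rpowIntegrand₀₁_Ioi hp hx.le
    refine ⟨(integrableOn_congr_fun heq measurableSet_Ioi).2 (hix.sub hi1), ?_⟩
    rw [setIntegral_congr_fun measurableSet_Ioi heq, integral_sub hix hi1,
      integral_rpowIntegrand₀₁_eq_rpow_mul_const hp hx.le]
    have : p - 1 ≠ 0 := by linarith
    field_simp

/-- The Bregman divergence of `-log` between `x + t` and `1 + t`. -/
noncomputable def logGap (t x : ℝ) : ℝ := log (1 + t) + (x - 1) / (1 + t) - log (x + t)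

theorem logGap_nonneg {t x : ℝ} (ht : 0 < t) (hx : 0 < x) : 0 ≤ logGap t x := by
  have h := log_le_sub_one_of_pos (show 0 < (x + t) / (1 + t) by positivity)
  rw [log_div (by positivity) (by positivity)] at h
  have : (x + t) / (1 + t) - 1 = (x - 1) / (1 + t) := by field_simp; ring
  unfold logGap
  linarith

theorem logGap_le {t x : ℝ} (ht : 0 < t) (hx : 0 < x) :
    logGap t x ≤ (x - 1) * ((1 + t)⁻¹ - (x + t)⁻¹) := by
  have h := log_le_sub_one_of_pos (show 0 < (1 + t) / (x + t) by positivity)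
  rw [log_div (by positivity) (by positivity)] at h
  have : (1 + t) / (x + t) - 1 = -(x - 1) * (x + t)⁻¹ := by field_simp; ring
  unfold logGap
  rw [div_eq_mul_inv]
  linarith

theorem hasDerivAt_logGap {t x : ℝ} (ht : 0 < t) (hx : 0 < x) :
    HasDerivAt (logGap t) ((1 + t)⁻¹ - (x + t)⁻¹) x := by
  have h1 : HasDerivAt (fun x : ℝ => log (1 + t) + (x - 1) / (1 + t)) (1 / (1 + t)) x :=
    (((hasDerivAt_id x).sub_const 1).div_const _).const_add _
  have h2 : HasDerivAt (fun x : ℝ => log (x + t)) (1 / (x + t)) x :=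
    ((hasDerivAt_id x).add_const t).log (by simp only [id]; positivity)
  have h3 := h1.fun_sub h2
  rw [one_div, one_div] at h3
  exact h3

theorem aestronglyMeasurable_rpow_mul_logGap (p x : ℝ) :
    AEStronglyMeasurable (fun t : ℝ => t ^ (p - 1) * logGap t x) (volume.restrict (Ioi 0)) := by
  apply Measurable.aestronglyMeasurable
  unfold logGap
  fun_prop

theorem integrableOn_rpow_mul_logGap {p : ℝ} (hp0 : 0 < p) (hp2 : p < 2) (hp1 : p ≠ 1) {x : ℝ}
    (hx : 0 < x) : IntegrableOn (fun t : ℝ => t ^ (p - 1) * logGap t x) (Ioi 0) := by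
  obtain ⟨K, -, hK⟩ := integral_rpow_mul_inv_sub_inv hp0 hp2 hp1
  refine Integrable.mono' ((hK x hx).1.const_mul (x - 1))
    (aestronglyMeasurable_rpow_mul_logGap p x) ?_
  refine (ae_restrict_iff' measurableSet_Ioi).2 (.of_forall fun t ht => ?_)
  have ht : 0 < t := ht
  have hpow : 0 ≤ t ^ (p - 1) := by positivity
  rw [norm_of_nonneg (mul_nonneg hpow (logGap_nonneg ht hx))]
  calc t ^ (p - 1) * logGap t x ≤ t ^ (p - 1) * ((x - 1) * ((1 + t)⁻¹ - (x + t)⁻¹)) :=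
        mul_le_mul_of_nonneg_left (logGap_le ht hx) hpow
    _ = _ := by ring

theorem hasDerivAt_integral_rpow_mul_logGap {p : ℝ} (hp0 : 0 < p) (hp2 : p < 2) (hp1 : p ≠ 1)
    {x : ℝ} (hx : 0 < x) :
    HasDerivAt (fun x => ∫ t in Ioi (0 : ℝ), t ^ (p - 1) * logGap t x)
      (∫ t in Ioi (0 : ℝ), t ^ (p - 1) * ((1 + t)⁻¹ - (x + t)⁻¹)) x := by
  obtain ⟨K, -, hK⟩ := integral_rpow_mul_inv_sub_inv hp0 hp2 hp1
  have hu : Ioo (min x 1 / 2) (x + 1) ∈ nhds x := by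
    refine Ioo_mem_nhds ?_ (by linarith)
    have := min_le_left x 1
    linarith
  set y := min x 1 / 2 with hy
  have hy0 : 0 < y := by positivity
  have hy1 : y < 1 := by have := min_le_right x 1; linarith
  refine (hasDerivAt_integral_of_dominated_loc_of_deriv_le
    (μ := volume.restrict (Ioi (0 : ℝ))) (F := fun x t => t ^ (p - 1) * logGap t x)
    (F' := fun x t => t ^ (p - 1) * ((1 + t)⁻¹ - (x + t)⁻¹))
    (bound := fun t => -((x + 2) / (1 - y)) * (t ^ (p - 1) * ((1 + t)⁻¹ - (y + t)⁻¹)))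
    hu (.of_forall fun z => aestronglyMeasurable_rpow_mul_logGap p z)
    (integrableOn_rpow_mul_logGap hp0 hp2 hp1 hx) (hK x hx).1.aestronglyMeasurable ?_
    ((hK y hy0).1.const_mul _) ?_).2
  · refine (ae_restrict_iff' measurableSet_Ioi).2 (.of_forall fun t ht z hz => ?_)
    have ht : 0 < t := ht
    have hz0 : 0 < z := hy0.trans hz.1
    have hpow : 0 ≤ t ^ (p - 1) := by positivity
    have e1 : (1 + t)⁻¹ - (z + t)⁻¹ = (z - 1) * ((1 + t)⁻¹ * (z + t)⁻¹) := by field_simp; ring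
    have e2 : -((x + 2) / (1 - y)) * (t ^ (p - 1) * ((1 + t)⁻¹ - (y + t)⁻¹)) =
        t ^ (p - 1) * ((x + 2) * ((1 + t)⁻¹ * (y + t)⁻¹)) := by
      have : 1 - y ≠ 0 := by linarith
      field_simp
      ring
    rw [e2, norm_mul, norm_of_nonneg hpow, e1, norm_mul,
      norm_of_nonneg (show 0 ≤ (1 + t)⁻¹ * (z + t)⁻¹ by positivity)]
    have h3 : ‖z - 1‖ ≤ x + 2 := by
      rw [norm_eq_abs, abs_le]
      exact ⟨by linarith, by linarith [hz.2]⟩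
    have h4 := hz.1.le
    gcongr
  · refine (ae_restrict_iff' measurableSet_Ioi).2 (.of_forall fun t ht z hz => ?_)
    exact (hasDerivAt_logGap ht (hy0.trans hz.1)).const_mul _

theorem exists_integral_rpow_mul_logGap_eq {p : ℝ} (hp0 : 0 < p) (hp2 : p < 2) (hp1 : p ≠ 1) :
    ∃ K : ℝ, 0 < K ∧ ∀ x : ℝ, 0 < x →
      ∫ t in Ioi (0 : ℝ), t ^ (p - 1) * logGap t x =
        K * ((x ^ p - 1 - p * (x - 1)) / (p - 1)) := by
  obtain ⟨K, hK0, hK⟩ := integral_rpow_mul_inv_sub_inv hp0 hp2 hp1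
  refine ⟨K / p, by positivity, fun x hx => ?_⟩
  have hp1' : p - 1 ≠ 0 := sub_ne_zero.2 hp1
  have hd : ∀ z ∈ Ioi (0 : ℝ), HasDerivAt (fun x => (∫ t in Ioi (0 : ℝ), t ^ (p - 1) * logGap t x)
      - K / p * ((x ^ p - 1 - p * (x - 1)) / (p - 1))) 0 z := by
    intro z hz
    have hz : 0 < z := hz
    have h1 := hasDerivAt_integral_rpow_mul_logGap hp0 hp2 hp1 hz
    rw [(hK z hz).2] at h1
    have h2 : HasDerivAt (fun x : ℝ => K / p * ((x ^ p - 1 - p * (x - 1)) / (p - 1)))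
        (K / p * ((p * z ^ (p - 1) - p * 1) / (p - 1))) z :=
      (((((hasDerivAt_rpow_const (.inl hz.ne')).sub_const 1).sub
        (((hasDerivAt_id z).sub_const 1).const_mul p)).div_const _).const_mul _)
    refine (h1.fun_sub h2).congr_deriv ?_
    field_simp
    ring
  have hconst := (convex_Ioi (0 : ℝ)).is_const_of_fderivWithin_eq_zero (𝕜 := ℝ)
    (f := fun x => (∫ t in Ioi (0 : ℝ), t ^ (p - 1) * logGap t x)
      - K / p * ((x ^ p - 1 - p * (x - 1)) / (p - 1)))
    (fun z hz => (hd z hz).differentiableAt.differentiableWithinAt)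
    (fun z hz => by
      rw [((hd z hz).hasFDerivAt.hasFDerivWithinAt).fderivWithin
        (isOpen_Ioi.uniqueDiffWithinAt hz)]
      ext; simp)
    hx (mem_Ioi.2 one_pos)
  simp only [logGap, sub_self, zero_div, add_zero, mul_zero, one_rpow, integral_zero] at hconst
  simpa [sub_eq_zero, logGap] using hconst

theorem sqrt_integral_triangle {s : Set ℝ} (hs : MeasurableSet s) {f g h : ℝ → ℝ}
    (hf : ∀ t ∈ s, 0 ≤ f t) (hg : ∀ t ∈ s, 0 ≤ g t) (hh : ∀ t ∈ s, 0 ≤ h t)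
    (hfi : IntegrableOn f s) (hgi : IntegrableOn g s) (hhi : IntegrableOn h s)
    (H : ∀ t ∈ s, sqrt (f t) ≤ sqrt (g t) + sqrt (h t)) :
    sqrt (∫ t in s, f t) ≤ sqrt (∫ t in s, g t) + sqrt (∫ t in s, h t) := by
  set U := ∫ t in s, g t
  set V := ∫ t in s, h t
  have hU : 0 ≤ U := setIntegral_nonneg hs hg
  have hV : 0 ≤ V := setIntegral_nonneg hs hh
  have hpt : ∀ c : ℝ, 0 < c → ∫ t in s, f t ≤ (1 + c) * U + (1 + c⁻¹) * V := by
    intro c hc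
    rw [← integral_const_mul, ← integral_const_mul,
      ← integral_add (hgi.const_mul _) (hhi.const_mul _)]
    refine setIntegral_mono_on hfi ((hgi.const_mul _).add (hhi.const_mul _)) hs fun t ht => ?_
    have h1 := pow_le_pow_left₀ (sqrt_nonneg _) (H t ht) 2
    rw [sq_sqrt (hf t ht), add_sq, sq_sqrt (hg t ht), sq_sqrt (hh t ht)] at h1
    have h2 : c * g t + c⁻¹ * h t - 2 * sqrt (g t) * sqrt (h t) =
        c⁻¹ * (c * sqrt (g t) - sqrt (h t)) ^ 2 := by
      rw [sub_sq, mul_pow, sq_sqrt (hg t ht), sq_sqrt (hh t ht)]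
      field_simp
      ring
    have h3 : 0 ≤ c⁻¹ * (c * sqrt (g t) - sqrt (h t)) ^ 2 := by positivity
    linarith
  rw [sqrt_le_left (by positivity)]
  refine le_of_forall_pos_le_add fun δ hδ => ?_
  set ε := δ / (sqrt U + sqrt V + 1)
  have hε : 0 < ε := by positivity
  have hεδ : ε * (sqrt U + sqrt V) ≤ δ := by
    have : ε * (sqrt U + sqrt V + 1) = δ := by simp only [ε]; field_simp
    nlinarith
  have h := hpt ((sqrt V + ε) / (sqrt U + ε)) (by positivity)
  have e1 : (sqrt V + ε) / (sqrt U + ε) * U ≤ (sqrt V + ε) * sqrt U := by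
    rw [div_mul_eq_mul_div, div_le_iff₀ (by positivity), mul_assoc]
    refine mul_le_mul_of_nonneg_left ?_ (by positivity)
    nlinarith [sq_sqrt hU, sqrt_nonneg U]
  have e2 : ((sqrt V + ε) / (sqrt U + ε))⁻¹ * V ≤ (sqrt U + ε) * sqrt V := by
    rw [inv_div, div_mul_eq_mul_div, div_le_iff₀ (by positivity), mul_assoc]
    refine mul_le_mul_of_nonneg_left ?_ (by positivity)
    nlinarith [sq_sqrt hV, sqrt_nonneg V]
  nlinarith [sq_sqrt hU, sq_sqrt hV]

end LogKernel

section ScalarMetric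

open Real Set

theorem mul_tanh_le_two_mul_log_cosh {u : ℝ} (hu : 0 ≤ u) :
    u * sinh u ≤ 2 * log (cosh u) * cosh u := by
  have hd : ∀ z : ℝ, HasDerivAt (fun u => 2 * log (cosh u) - u * (sinh u / cosh u))
      ((sinh z * cosh z - z) / cosh z ^ 2) z := by
    intro z
    have hc := (cosh_pos z).ne'
    have h := (((hasDerivAt_cosh z).log hc).const_mul 2).sub
      ((hasDerivAt_id z).mul ((hasDerivAt_sinh z).div (hasDerivAt_cosh z) hc))
    refine HasDerivAt.congr_deriv h ?_
    simp only [id, Pi.div_apply]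
    field_simp
    linear_combination (-z) * cosh_sq z
  have hmono : MonotoneOn (fun u => 2 * log (cosh u) - u * (sinh u / cosh u)) (Ici 0) := by
    refine monotoneOn_of_deriv_nonneg (convex_Ici 0)
      (fun z _ => (hd z).continuousAt.continuousWithinAt)
      (fun z _ => (hd z).differentiableAt.differentiableWithinAt) fun z hz => ?_
    rw [interior_Ici] at hz
    have hz : 0 < z := hz
    rw [(hd z).deriv]
    have h1 : z ≤ sinh z := self_le_sinh_iff.2 hz.le
    have h2 := one_le_cosh z
    have h3 : 0 ≤ sinh z * cosh z - z := by nlinarith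
    positivity
  have h := hmono self_mem_Ici (mem_Ici.2 hu) hu
  simp only [cosh_zero, log_one, mul_zero, zero_mul, sub_zero] at h
  have hc := cosh_pos u
  have : u * (sinh u / cosh u) * cosh u = u * sinh u := by field_simp
  nlinarith

theorem antitoneOn_log_cosh_div_sq :
    AntitoneOn (fun u => log (cosh u) / u ^ 2) (Ioi 0) := by
  have hd : ∀ z : ℝ, 0 < z → HasDerivAt (fun u => log (cosh u) / u ^ 2)
      ((sinh z / cosh z * z ^ 2 - log (cosh z) * (2 * z)) / (z ^ 2) ^ 2) z := by
    intro z hz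
    have h := ((hasDerivAt_cosh z).log (cosh_pos z).ne').fun_div (hasDerivAt_pow 2 z)
      (pow_ne_zero 2 hz.ne')
    simpa using h
  refine antitoneOn_of_deriv_nonpos (convex_Ioi 0)
    (fun z hz => (hd z hz).continuousAt.continuousWithinAt)
    (fun z hz => (hd z (interior_subset hz)).differentiableAt.differentiableWithinAt)
    fun z hz => ?_
  rw [interior_Ioi] at hz
  have hz : 0 < z := hz
  rw [(hd z hz).deriv]
  have hc := cosh_pos z
  have h1 := mul_tanh_le_two_mul_log_cosh hz.le
  refine div_nonpos_of_nonpos_of_nonneg ?_ (by positivity)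
  have e : sinh z / cosh z * z ^ 2 - log (cosh z) * (2 * z) =
      z / cosh z * (z * sinh z - 2 * log (cosh z) * cosh z) := by field_simp
  rw [e]
  exact mul_nonpos_of_nonneg_of_nonpos (by positivity) (by linarith)

theorem log_cosh_nonneg (u : ℝ) : 0 ≤ log (cosh u) := log_nonneg (one_le_cosh u)

theorem sqrt_log_cosh_mul_le {u v : ℝ} (hu : 0 < u) (huv : u ≤ v) :
    sqrt (log (cosh v)) * u ≤ sqrt (log (cosh u)) * v := by
  have hv : 0 < v := hu.trans_le huv
  have h := antitoneOn_log_cosh_div_sq (show u ∈ Ioi 0 from hu) (show v ∈ Ioi 0 from hv) huv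
  simp only at h
  rw [div_le_div_iff₀ (by positivity) (by positivity)] at h
  have h2 := sqrt_le_sqrt h
  rwa [sqrt_mul (log_cosh_nonneg v), sqrt_mul (log_cosh_nonneg u), sqrt_sq hu.le,
    sqrt_sq hv.le] at h2

theorem sqrt_log_cosh_add_le (u v : ℝ) :
    sqrt (log (cosh (u + v))) ≤ sqrt (log (cosh u)) + sqrt (log (cosh v)) := by
  have key : ∀ a b : ℝ, 0 ≤ a → 0 ≤ b →
      sqrt (log (cosh (a + b))) ≤ sqrt (log (cosh a)) + sqrt (log (cosh b)) := by
    intro a b ha hb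
    rcases ha.eq_or_lt with rfl | ha
    · simp
    rcases hb.eq_or_lt with rfl | hb
    · simp
    have h1 := sqrt_log_cosh_mul_le ha (show a ≤ a + b by linarith)
    have h2 := sqrt_log_cosh_mul_le hb (show b ≤ a + b by linarith)
    refine le_of_mul_le_mul_right (a := a + b) ?_ (by positivity)
    linarith
  have h := key |u| |v| (abs_nonneg u) (abs_nonneg v)
  rw [cosh_abs, cosh_abs] at h
  refine le_trans (sqrt_le_sqrt (log_le_log (cosh_pos _) ?_)) h
  rw [cosh_le_cosh, abs_of_nonneg (a := |u| + |v|) (by positivity)]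
  exact abs_add_le u v

/-- The scalar Stein divergence. -/
noncomputable def scalarStein (x y : ℝ) : ℝ := 2 * log ((x + y) / 2) - log x - log y

theorem scalarStein_eq {x y : ℝ} (hx : 0 < x) (hy : 0 < y) :
    scalarStein x y = 2 * log (cosh ((log x - log y) / 2)) := by
  have h : cosh ((log x - log y) / 2) ^ 2 = ((x + y) / 2) ^ 2 / (x * y) := by
    have h1 : cosh (log x - log y) = (x / y + y / x) / 2 := by
      rw [cosh_eq, exp_sub, neg_sub, exp_sub, exp_log hx, exp_log hy]
    have h2 := cosh_two_mul ((log x - log y) / 2)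
    rw [mul_div_cancel₀ _ (two_ne_zero' ℝ), h1, sinh_sq] at h2
    have h3 : cosh ((log x - log y) / 2) ^ 2 = ((x / y + y / x) / 2 + 1) / 2 := by linarith
    rw [h3]
    field_simp
    ring
  have h' := congrArg log h
  rw [log_pow, log_div (by positivity) (by positivity), log_pow,
    log_mul hx.ne' hy.ne'] at h'
  push_cast at h'
  unfold scalarStein
  linarith

theorem scalarStein_nonneg {x y : ℝ} (hx : 0 < x) (hy : 0 < y) : 0 ≤ scalarStein x y := by
  rw [scalarStein_eq hx hy]
  have := log_cosh_nonneg ((log x - log y) / 2)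
  positivity

theorem eq_of_scalarStein_eq_zero {x y : ℝ} (hx : 0 < x) (hy : 0 < y)
    (h : scalarStein x y = 0) : x = y := by
  rw [scalarStein_eq hx hy] at h
  have h0 : log (cosh ((log x - log y) / 2)) = 0 := by linarith
  have h1 : cosh ((log x - log y) / 2) = 1 := by
    rw [← exp_log (cosh_pos _), h0, exp_zero]
  have h2 : (log x - log y) / 2 = 0 := by
    by_contra hne
    exact (one_lt_cosh.2 hne).ne' h1
  exact log_injOn_pos hx hy (by linarith)

theorem sqrt_scalarStein_triangle {x y z : ℝ} (hx : 0 < x) (hy : 0 < y) (hz : 0 < z) :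
    sqrt (scalarStein x z) ≤ sqrt (scalarStein x y) + sqrt (scalarStein y z) := by
  rw [scalarStein_eq hx hy, scalarStein_eq hy hz, scalarStein_eq hx hz]
  simp only [sqrt_mul zero_le_two]
  rw [← mul_add]
  refine mul_le_mul_of_nonneg_left ?_ (sqrt_nonneg _)
  have h := sqrt_log_cosh_add_le ((log x - log y) / 2) ((log y - log z) / 2)
  rwa [show (log x - log y) / 2 + (log y - log z) / 2 = (log x - log z) / 2 by ring] at h

theorem sqrt_sum_triangle {ι : Type*} (s : Finset ι) {f g h : ι → ℝ}
    (hf : ∀ i ∈ s, 0 ≤ f i) (hg : ∀ i ∈ s, 0 ≤ g i) (hh : ∀ i ∈ s, 0 ≤ h i)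
    (H : ∀ i ∈ s, sqrt (f i) ≤ sqrt (g i) + sqrt (h i)) :
    sqrt (∑ i ∈ s, f i) ≤ sqrt (∑ i ∈ s, g i) + sqrt (∑ i ∈ s, h i) := by
  have hM := Real.Lp_add_le_of_nonneg s (p := 2) one_le_two (f := fun i => sqrt (g i))
    (g := fun i => sqrt (h i)) (fun i _ => sqrt_nonneg _) (fun i _ => sqrt_nonneg _)
  simp only [rpow_two, ← sqrt_eq_rpow] at hM
  rw [Finset.sum_congr rfl fun i hi => sq_sqrt (hg i hi),
    Finset.sum_congr rfl fun i hi => sq_sqrt (hh i hi)] at hM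
  refine le_trans (sqrt_le_sqrt (Finset.sum_le_sum fun i hi => ?_)) hM
  calc f i = sqrt (f i) ^ 2 := (sq_sqrt (hf i hi)).symm
    _ ≤ _ := pow_le_pow_left₀ (sqrt_nonneg _) (H i hi) 2

end ScalarMetric

section SteinDivergence

open Finset

variable {n : Type*} [Fintype n] [DecidableEq n]

theorem exists_perm_sum_mul_le_of_mem_doublyStochastic {w : Matrix n n ℝ}
    (hw : w ∈ doublyStochastic ℝ n) (f g : n → ℝ) :
    ∃ σ : Equiv.Perm n, ∑ i, f i * g (σ i) ≤ ∑ i, ∑ j, f i * w i j * g j := by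
  obtain ⟨c, hc0, hc1, rfl⟩ := exists_eq_sum_perm_of_mem_doublyStochastic hw
  have key : ∑ i, ∑ j, f i * (∑ σ, c σ • σ.permMatrix ℝ) i j * g j =
      ∑ σ, c σ * ∑ i, f i * g (σ i) := by
    have h1 : ∀ i, ∑ j, f i * (∑ σ, c σ • σ.permMatrix ℝ) i j * g j =
        ∑ σ, c σ * (f i * g (σ i)) := by
      intro i
      simp only [Matrix.sum_apply, Matrix.smul_apply, smul_eq_mul, mul_sum, sum_mul]
      rw [sum_comm]
      refine sum_congr rfl fun σ _ => ?_
      rw [sum_eq_single (σ i)]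
      · simp [Equiv.Perm.permMatrix, PEquiv.toMatrix_apply]
        ring
      · intro j _ hj
        simp [Equiv.Perm.permMatrix, PEquiv.toMatrix_apply, hj.symm]
      · simp
    simp only [h1, mul_sum]
    rw [sum_comm]
  rw [key]
  obtain ⟨σ, -, hσ⟩ := exists_min_image univ (fun σ : Equiv.Perm n => ∑ i, f i * g (σ i))
    univ_nonempty
  refine ⟨σ, ?_⟩
  calc ∑ i, f i * g (σ i) = ∑ τ, c τ * ∑ i, f i * g (σ i) := by rw [← sum_mul, hc1, one_mul]
    _ ≤ _ := sum_le_sum fun τ _ => mul_le_mul_of_nonneg_left (hσ τ (mem_univ τ)) (hc0 τ)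

theorem normSq_mem_doublyStochastic (U : unitaryGroup n ℂ) :
    Matrix.of (fun i j => Complex.normSq ((U : Matrix n n ℂ) i j)) ∈ doublyStochastic ℝ n := by
  rw [mem_doublyStochastic_iff_sum]
  refine ⟨fun i j => Complex.normSq_nonneg _, fun i => ?_, fun j => ?_⟩
  · have h := congrFun (congrFun (mem_unitaryGroup_iff.1 U.2) i) i
    simp only [mul_apply, star_apply, one_apply_eq, RCLike.star_def, Complex.mul_conj] at h
    exact_mod_cast h
  · have h := congrFun (congrFun (mem_unitaryGroup_iff'.1 U.2) j) j
    simp only [mul_apply, star_apply, one_apply_eq, RCLike.star_def,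
      ← Complex.normSq_eq_conj_mul_self] at h
    exact_mod_cast h

theorem trace_cfc_mul_cfc {A B : Matrix n n ℂ} (hA : A.IsHermitian) (hB : B.IsHermitian)
    (f g : ℝ → ℝ) :
    (hA.cfc f * hB.cfc g).trace.re = ∑ i, ∑ j, f (hA.eigenvalues i) *
      Complex.normSq ((star hA.eigenvectorUnitary * hB.eigenvectorUnitary :
        unitaryGroup n ℂ).1 i j) * g (hB.eigenvalues j) := by
  set V := hA.eigenvectorUnitary
  set W := hB.eigenvectorUnitary
  have h : (hA.cfc f * hB.cfc g).trace =
      (diagonal (fun i => (f (hA.eigenvalues i) : ℂ)) * (star V * W : unitaryGroup n ℂ).1 *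
        diagonal (fun i => (g (hB.eigenvalues i) : ℂ)) *
          star (star V * W : unitaryGroup n ℂ).1).trace := by
    simp only [IsHermitian.cfc, Unitary.conjStarAlgAut_apply, MulMemClass.coe_mul, star_mul,
      Unitary.coe_star, star_star]
    rw [mul_assoc, mul_assoc, trace_mul_comm]
    simp only [mul_assoc]
    rfl
  rw [h]
  simp only [trace, diag_apply, mul_apply (M := _ * diagonal _), mul_diagonal, diagonal_mul,
    star_apply, RCLike.star_def, Complex.re_sum]
  refine sum_congr rfl fun i _ => sum_congr rfl fun j _ => ?_
  generalize (star V * W : unitaryGroup n ℂ).1 i j = u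
  have : (f (hA.eigenvalues i) : ℂ) * u * g (hB.eigenvalues j) * (starRingEnd ℂ) u =
      ((f (hA.eigenvalues i) * Complex.normSq u * g (hB.eigenvalues j) : ℝ) : ℂ) := by
    push_cast
    rw [← Complex.mul_conj]
    ring
  rw [this, Complex.ofReal_re]

theorem trace_cfc {A : Matrix n n ℂ} (hA : A.IsHermitian) (f : ℝ → ℝ) :
    (hA.cfc f).trace.re = ∑ i, f (hA.eigenvalues i) := by
  rw [IsHermitian.cfc, Unitary.conjStarAlgAut_apply, trace_mul_cycle, Unitary.coe_star_mul_self,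
    one_mul, trace_diagonal, Complex.re_sum]
  rfl

theorem norm_det_cfc {A : Matrix n n ℂ} (hA : A.IsHermitian) (f : ℝ → ℝ) :
    ‖(hA.cfc f).det‖ = ∏ i, |f (hA.eigenvalues i)| := by
  rw [IsHermitian.cfc, Unitary.conjStarAlgAut_apply, det_mul_comm, ← mul_assoc,
    Unitary.coe_star_mul_self, one_mul, det_diagonal, norm_prod]
  exact prod_congr rfl fun i _ => Complex.norm_real _

theorem cfc_self {A : Matrix n n ℂ} (hA : A.IsHermitian) : hA.cfc (fun x => x) = A := by
  rw [← hA.cfc_eq]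
  exact cfc_id' ℝ A hA

theorem cfc_mul_cfc {A : Matrix n n ℂ} (hA : A.IsHermitian) (f g : ℝ → ℝ) :
    hA.cfc f * hA.cfc g = hA.cfc (fun x => f x * g x) := by
  simp only [← hA.cfc_eq]
  exact (cfc_mul f g A (A.finite_real_spectrum.continuousOn f)
    (A.finite_real_spectrum.continuousOn g)).symm

theorem cfc_congr_pos {A : Matrix n n ℂ} (hA : A.PosDef) {f g : ℝ → ℝ}
    (h : ∀ x, 0 < x → f x = g x) : hA.1.cfc f = hA.1.cfc g := by
  have : f ∘ hA.1.eigenvalues = g ∘ hA.1.eigenvalues :=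
    funext fun i => h _ (hA.eigenvalues_pos i)
  rw [IsHermitian.cfc, IsHermitian.cfc, this]

theorem isHermitian_cfc_one {A : Matrix n n ℂ} (hA : A.IsHermitian) : hA.cfc (fun _ => 1) = 1 := by
  rw [← hA.cfc_eq]
  exact cfc_const_one ℝ A hA

theorem smul_add_smul_one_eq_cfc {A : Matrix n n ℂ} (hA : A.IsHermitian) (c t : ℝ) :
    c • (A + t • (1 : Matrix n n ℂ)) = hA.cfc (fun x => c * (x + t)) := by
  have hc := fun f : ℝ → ℝ => A.finite_real_spectrum.continuousOn f
  rw [← hA.cfc_eq, cfc_const_mul c _ A (hc _), cfc_add (a := A) (fun x => x) (fun _ => t)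
    (hc _) (hc _), cfc_id' ℝ A hA.isSelfAdjoint,
    cfc_const t A hA.isSelfAdjoint, Algebra.algebraMap_eq_smul_one]

theorem norm_det_eq_prod_eigenvalues {A : Matrix n n ℂ} (hA : A.PosDef) :
    ‖A.det‖ = ∏ i, hA.1.eigenvalues i := by
  conv_lhs => rw [← cfc_self hA.1]
  rw [norm_det_cfc]
  exact prod_congr rfl fun i _ => abs_of_pos (hA.eigenvalues_pos i)

theorem log_norm_det {A : Matrix n n ℂ} (hA : A.PosDef) :
    Real.log ‖A.det‖ = ∑ i, Real.log (hA.1.eigenvalues i) := by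
  rw [norm_det_eq_prod_eigenvalues hA, Real.log_prod fun i _ => (hA.eigenvalues_pos i).ne']

theorem exists_perm_sum_inv_mul_le_trace {P A : Matrix n n ℂ} (hP : P.IsHermitian)
    (hA : A.IsHermitian) : ∃ σ : Equiv.Perm n,
      ∑ i, (hP.eigenvalues i)⁻¹ * hA.eigenvalues (σ i) ≤ (hP.cfc (·⁻¹) * A).trace.re := by
  conv => enter [1, σ, 2]; rw [← cfc_self hA]
  rw [trace_cfc_mul_cfc]
  exact exists_perm_sum_mul_le_of_mem_doublyStochastic (normSq_mem_doublyStochastic _)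
    (fun i => (hP.eigenvalues i)⁻¹) hA.eigenvalues

theorem posDef_midpoint {m : Type*} {A B : Matrix m m ℂ} (hA : A.PosDef) (hB : B.PosDef) :
    ((1 / 2 : ℝ) • (A + B)).PosDef :=
  (hA.add hB).smul (by norm_num)

/-- A form of Fiedler's inequality for the determinant of a sum of positive definite matrices. -/
theorem exists_perm_sum_log_le_log_det {A B : Matrix n n ℂ} (hA : A.PosDef) (hB : B.PosDef) :
    ∃ σ τ : Equiv.Perm n,
      ∑ i, Real.log ((hA.1.eigenvalues (σ i) + hB.1.eigenvalues (τ i)) / 2) ≤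
        Real.log ‖((1 / 2 : ℝ) • (A + B)).det‖ := by
  have hP := posDef_midpoint hA hB
  obtain ⟨σ, hσ⟩ := exists_perm_sum_inv_mul_le_trace hP.1 hA.1
  obtain ⟨τ, hτ⟩ := exists_perm_sum_inv_mul_le_trace hP.1 hB.1
  refine ⟨σ, τ, ?_⟩
  set p := hP.1.eigenvalues
  have hp : ∀ i, 0 < p i := hP.eigenvalues_pos
  have htr : (hP.1.cfc (·⁻¹) * A).trace.re + (hP.1.cfc (·⁻¹) * B).trace.re =
      2 * Fintype.card n := by
    have h1 : hP.1.cfc (·⁻¹) * ((1 / 2 : ℝ) • (A + B)) = 1 := by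
      conv_lhs => enter [2]; rw [← cfc_self hP.1]
      rw [cfc_mul_cfc, cfc_congr_pos hP (g := fun _ => 1) fun x hx => inv_mul_cancel₀ hx.ne',
        isHermitian_cfc_one]
    have h2 := congrArg (fun M => M.trace.re) h1
    simp only [mul_smul_comm, trace_smul, mul_add, trace_add, Complex.smul_re, Complex.add_re,
      trace_one, Complex.natCast_re, smul_eq_mul] at h2
    linarith
  rw [log_norm_det hP, ← sub_nonpos, ← sum_sub_distrib]
  have hA0 := hA.eigenvalues_pos
  have hB0 := hB.eigenvalues_pos
  calc _ ≤ ∑ i, ((p i)⁻¹ * ((hA.1.eigenvalues (σ i) + hB.1.eigenvalues (τ i)) / 2) - 1) := by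
        refine sum_le_sum fun i _ => ?_
        have hs : 0 < (hA.1.eigenvalues (σ i) + hB.1.eigenvalues (τ i)) / 2 := by
          linarith [hA0 (σ i), hB0 (τ i)]
        rw [← Real.log_div hs.ne' (hp i).ne', inv_mul_eq_div]
        exact Real.log_le_sub_one_of_pos (div_pos hs (hp i))
    _ = (∑ i, (p i)⁻¹ * hA.1.eigenvalues (σ i) + ∑ i, (p i)⁻¹ * hB.1.eigenvalues (τ i)) / 2
        - Fintype.card n := by
        rw [sum_sub_distrib, ← sum_add_distrib, sum_div]
        congr 1
        · exact sum_congr rfl fun i _ => by ring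
        · simp
    _ ≤ 0 := by linarith

/-- The Stein divergence (twice the S-divergence) of positive definite matrices. -/
noncomputable def stein (A B : Matrix n n ℂ) : ℝ :=
  2 * Real.log ‖((1 / 2 : ℝ) • (A + B)).det‖ - Real.log ‖A.det‖ - Real.log ‖B.det‖

theorem exists_perm_sum_scalarStein_le {A B : Matrix n n ℂ} (hA : A.PosDef) (hB : B.PosDef) :
    ∃ σ τ : Equiv.Perm n,
      ∑ i, scalarStein (hA.1.eigenvalues (σ i)) (hB.1.eigenvalues (τ i)) ≤ stein A B := by
  obtain ⟨σ, τ, h⟩ := exists_perm_sum_log_le_log_det hA hB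
  refine ⟨σ, τ, ?_⟩
  unfold stein scalarStein
  rw [sum_sub_distrib, sum_sub_distrib, ← mul_sum, log_norm_det hA, log_norm_det hB,
    Equiv.sum_comp σ fun i => Real.log (hA.1.eigenvalues i),
    Equiv.sum_comp τ fun i => Real.log (hB.1.eigenvalues i)]
  linarith

theorem stein_nonneg {A B : Matrix n n ℂ} (hA : A.PosDef) (hB : B.PosDef) : 0 ≤ stein A B := by
  obtain ⟨σ, τ, h⟩ := exists_perm_sum_scalarStein_le hA hB
  exact (sum_nonneg fun i _ =>
    scalarStein_nonneg (hA.eigenvalues_pos _) (hB.eigenvalues_pos _)).trans h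

theorem stein_one {B : Matrix n n ℂ} (hB : B.PosDef) :
    stein 1 B = ∑ i, scalarStein 1 (hB.1.eigenvalues i) := by
  have h : (1 / 2 : ℝ) • (1 + B) = hB.1.cfc (fun x => (1 / 2) * (x + 1)) := by
    rw [← smul_add_smul_one_eq_cfc, one_smul, add_comm]
  have hpos := hB.eigenvalues_pos
  have hpos' : ∀ i, 0 < (1 / 2) * (hB.1.eigenvalues i + 1) := fun i => by
    linarith [hpos i]
  unfold stein scalarStein
  rw [h, norm_det_cfc, log_norm_det hB, Real.log_prod fun i _ => (abs_pos.2 (hpos' i).ne').ne',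
    sum_sub_distrib, sum_sub_distrib, ← mul_sum]
  simp only [Real.log_abs, det_one, norm_one, Real.log_one, sum_const_zero, one_div,
    inv_mul_eq_div, add_comm (1 : ℝ)]

theorem stein_conj {M : Matrix n n ℂ} (hM : M.det ≠ 0) {A B : Matrix n n ℂ} (hA : A.PosDef)
    (hB : B.PosDef) : stein (Mᴴ * A * M) (Mᴴ * B * M) = stein A B := by
  have hlog : ∀ C : Matrix n n ℂ, C.PosDef → Real.log ‖(Mᴴ * C * M).det‖ =
      2 * Real.log ‖M.det‖ + Real.log ‖C.det‖ := by
    intro C hC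
    have h1 := norm_ne_zero_iff.2 hM
    have h2 : ‖C.det‖ ≠ 0 := norm_ne_zero_iff.2 hC.det_pos.ne'
    rw [det_mul, det_mul, det_conjTranspose, norm_mul, norm_mul, norm_star,
      Real.log_mul (mul_ne_zero h1 h2) h1, Real.log_mul h1 h2]
    ring
  have hmid : (1 / 2 : ℝ) • (Mᴴ * A * M + Mᴴ * B * M) = Mᴴ * ((1 / 2 : ℝ) • (A + B)) * M := by
    simp only [mul_smul_comm, smul_mul_assoc, mul_add, add_mul]
  unfold stein
  rw [hmid, hlog _ (posDef_midpoint hA hB), hlog A hA, hlog B hB]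
  ring

theorem exists_conj_eq_one {A : Matrix n n ℂ} (hA : A.PosDef) :
    ∃ M : Matrix n n ℂ, M.det ≠ 0 ∧ Mᴴ * A * M = 1 := by
  have hM : (hA.1.cfc fun x => x ^ (-(1 / 2) : ℝ)).IsHermitian := by
    rw [← hA.1.cfc_eq]
    exact cfc_predicate _ A
  refine ⟨hA.1.cfc fun x => x ^ (-(1 / 2) : ℝ), ?_, ?_⟩
  · rw [← norm_ne_zero_iff, norm_det_cfc]
    exact prod_ne_zero_iff.2 fun i _ =>
      abs_ne_zero.2 (Real.rpow_pos_of_pos (hA.eigenvalues_pos i) _).ne'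
  · rw [hM.eq]
    conv_lhs => enter [1, 2]; rw [← cfc_self hA.1]
    rw [cfc_mul_cfc, cfc_mul_cfc, cfc_congr_pos hA (g := fun _ => 1), isHermitian_cfc_one]
    intro x hx
    rw [← Real.rpow_add_one hx.ne', ← Real.rpow_add hx]
    norm_num

theorem posDef_conj {M : Matrix n n ℂ} (hM : M.det ≠ 0) {A : Matrix n n ℂ} (hA : A.PosDef) :
    (Mᴴ * A * M).PosDef :=
  hA.conjTranspose_mul_mul_same
    (mulVec_injective_iff_isUnit.2 ((isUnit_iff_isUnit_det M).2 hM.isUnit))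

theorem sqrt_stein_triangle {A B C : Matrix n n ℂ} (hA : A.PosDef) (hB : B.PosDef)
    (hC : C.PosDef) : √(stein A C) ≤ √(stein A B) + √(stein B C) := by
  obtain ⟨M, hM, hMA⟩ := exists_conj_eq_one hA
  rw [← stein_conj hM hA hB, ← stein_conj hM hA hC, ← stein_conj hM hB hC, hMA]
  have hB' := posDef_conj hM hB
  have hC' := posDef_conj hM hC
  obtain ⟨σ, τ, h⟩ := exists_perm_sum_scalarStein_le hB' hC'
  have hb := hB'.eigenvalues_pos
  have hc := hC'.eigenvalues_pos
  rw [stein_one hB', stein_one hC',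
    ← Equiv.sum_comp σ fun i => scalarStein 1 (hB'.1.eigenvalues i),
    ← Equiv.sum_comp τ fun i => scalarStein 1 (hC'.1.eigenvalues i)]
  refine (sqrt_sum_triangle univ (fun i _ => scalarStein_nonneg one_pos (hc (τ i)))
    (fun i _ => scalarStein_nonneg one_pos (hb (σ i)))
    (fun i _ => scalarStein_nonneg (hb (σ i)) (hc (τ i)))
    fun i _ => sqrt_scalarStein_triangle one_pos (hb (σ i)) (hc (τ i))).trans ?_
  gcongr

theorem eq_of_stein_eq_zero {A B : Matrix n n ℂ} (hA : A.PosDef) (hB : B.PosDef)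
    (h : stein A B = 0) : A = B := by
  obtain ⟨M, hM, hMA⟩ := exists_conj_eq_one hA
  have hB' := posDef_conj hM hB
  have hb := hB'.eigenvalues_pos
  rw [← stein_conj hM hA hB, hMA, stein_one hB',
    sum_eq_zero_iff_of_nonneg fun i _ => scalarStein_nonneg one_pos (hb i)] at h
  have hone : Mᴴ * B * M = 1 := by
    rw [← cfc_self hB'.1, ← isHermitian_cfc_one hB'.1]
    have : (fun x => x) ∘ hB'.1.eigenvalues = (fun _ => 1) ∘ hB'.1.eigenvalues :=
      funext fun i => (eq_of_scalarStein_eq_zero one_pos (hb i) (h i (mem_univ i))).symm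
    rw [IsHermitian.cfc, IsHermitian.cfc, this]
  have hu : IsUnit M := (isUnit_iff_isUnit_det M).2 hM.isUnit
  have hu' : IsUnit Mᴴ := hu.star
  exact hu'.mul_left_cancel (hu.mul_right_cancel (hMA.trans hone.symm))

theorem stein_self {A : Matrix n n ℂ} : stein A A = 0 := by
  have : (1 / 2 : ℝ) • (A + A) = A := by
    rw [← two_smul ℝ, smul_smul]
    norm_num
  unfold stein
  rw [this]
  ring

end SteinDivergence

section TsallisDivergence

open Finset

section FunctionalCalculus

variable {n : Type*} [Fintype n] [DecidableEq n]

theorem isHermitian_cfc {A : Matrix n n ℂ} (hA : A.IsHermitian) (f : ℝ → ℝ) :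
    (hA.cfc f).IsHermitian := by
  rw [← hA.cfc_eq]
  exact cfc_predicate _ A

theorem posDef_cfc {A : Matrix n n ℂ} (hA : A.PosDef) {f : ℝ → ℝ} (hf : ∀ x, 0 < x → 0 < f x) :
    (hA.1.cfc f).PosDef := by
  have hdet : (hA.1.cfc fun x => √(f x)).det ≠ 0 := by
    rw [← norm_ne_zero_iff, norm_det_cfc]
    exact prod_ne_zero_iff.2 fun i _ =>
      abs_ne_zero.2 (Real.sqrt_pos.2 (hf _ (hA.eigenvalues_pos i))).ne'
  have h := posDef_conj hdet PosDef.one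
  rwa [(isHermitian_cfc hA.1 _).eq, mul_one, cfc_mul_cfc,
    cfc_congr_pos hA (g := f) fun x hx => Real.mul_self_sqrt (hf x hx).le] at h

theorem cfc_cfc {A : Matrix n n ℂ} (hA : A.IsHermitian) (f g : ℝ → ℝ)
    (h : (hA.cfc f).IsHermitian) : h.cfc g = hA.cfc (fun x => g (f x)) := by
  rw [← h.cfc_eq]
  simp only [← hA.cfc_eq]
  exact (cfc_comp' g f A ((A.finite_real_spectrum.image f).continuousOn g)
    (A.finite_real_spectrum.continuousOn f) hA.isSelfAdjoint).symm

theorem log_norm_det_add_smul_one {A : Matrix n n ℂ} (hA : A.PosDef) {t : ℝ} (ht : 0 < t) :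
    Real.log ‖(A + t • (1 : Matrix n n ℂ)).det‖ = ∑ i, Real.log (hA.1.eigenvalues i + t) := by
  have hpos := fun i => add_pos (hA.eigenvalues_pos i) ht
  rw [← one_smul ℝ (A + t • (1 : Matrix n n ℂ)), smul_add_smul_one_eq_cfc hA.1, norm_det_cfc]
  simp only [one_mul]
  rw [Real.log_prod fun i _ => (abs_pos.2 (hpos i).ne').ne']
  simp only [Real.log_abs]

theorem sum_eigenvalues_eq {A : Matrix n n ℂ} (hA : A.IsHermitian) :
    ∑ i, hA.eigenvalues i = A.trace.re := by
  conv_rhs => rw [← cfc_self hA]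
  rw [trace_cfc]

theorem posDef_add_smul_one {m : Type*} [DecidableEq m] {A : Matrix m m ℂ} (hA : A.PosDef)
    {t : ℝ} (ht : 0 < t) :
    (A + t • (1 : Matrix m m ℂ)).PosDef :=
  hA.add (PosDef.one.smul ht)

theorem sum_affine_eigenvalues_midpoint {A B : Matrix n n ℂ} (hA : A.PosDef) (hB : B.PosDef)
    (u v : ℝ) :
    ∑ i, (u + v * hA.1.eigenvalues i) + ∑ i, (u + v * hB.1.eigenvalues i) =
      2 * ∑ i, (u + v * (posDef_midpoint hA hB).1.eigenvalues i) := by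
  simp only [sum_add_distrib, ← mul_sum, sum_eigenvalues_eq, trace_smul, trace_add,
    Complex.smul_re, Complex.add_re, smul_eq_mul]
  ring

theorem stein_add_smul_one {A B : Matrix n n ℂ} (hA : A.PosDef) (hB : B.PosDef) {t : ℝ}
    (ht : 0 < t) : stein (A + t • (1 : Matrix n n ℂ)) (B + t • (1 : Matrix n n ℂ)) =
      ∑ i, logGap t (hA.1.eigenvalues i) + ∑ i, logGap t (hB.1.eigenvalues i) -
        2 * ∑ i, logGap t ((posDef_midpoint hA hB).1.eigenvalues i) := by
  have hmid : (1 / 2 : ℝ) • ((A + t • (1 : Matrix n n ℂ)) + (B + t • (1 : Matrix n n ℂ))) =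
      (1 / 2 : ℝ) • (A + B) + t • (1 : Matrix n n ℂ) := by
    module
  have hgap : ∀ x, logGap t x =
      (Real.log (1 + t) - (1 + t)⁻¹ + (1 + t)⁻¹ * x) - Real.log (x + t) := by
    intro x
    unfold logGap
    ring
  have haff := sum_affine_eigenvalues_midpoint hA hB (Real.log (1 + t) - (1 + t)⁻¹) (1 + t)⁻¹
  unfold stein
  rw [hmid, log_norm_det_add_smul_one hA ht, log_norm_det_add_smul_one hB ht,
    log_norm_det_add_smul_one (posDef_midpoint hA hB) ht]
  simp only [hgap, sum_sub_distrib (f := fun i => _ + _ * _)]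
  linarith

/-- Up to a positive factor, the Jensen gap of the trace function `x ↦ x ^ p / (p - 1)` is an
average of Stein divergences. -/
theorem exists_integral_rpow_mul_stein_eq {p : ℝ} (hp0 : 0 < p) (hp2 : p < 2) (hp1 : p ≠ 1) :
    ∃ K : ℝ, 0 < K ∧ ∀ (A B : Matrix n n ℂ) (hA : A.PosDef) (hB : B.PosDef),
      MeasureTheory.IntegrableOn (fun t : ℝ => t ^ (p - 1) *
        stein (A + t • (1 : Matrix n n ℂ)) (B + t • (1 : Matrix n n ℂ))) (Set.Ioi 0) ∧
      ∫ t in Set.Ioi (0 : ℝ), t ^ (p - 1) *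
        stein (A + t • (1 : Matrix n n ℂ)) (B + t • (1 : Matrix n n ℂ)) =
        K * ((∑ i, hA.1.eigenvalues i ^ p + ∑ i, hB.1.eigenvalues i ^ p -
          2 * ∑ i, (posDef_midpoint hA hB).1.eigenvalues i ^ p) / (p - 1)) := by
  obtain ⟨K, hK, h⟩ := exists_integral_rpow_mul_logGap_eq hp0 hp2 hp1
  refine ⟨K, hK, fun A B hA hB => ?_⟩
  have hC := posDef_midpoint hA hB
  have hitg : ∀ {M : Matrix n n ℂ} (hM : M.PosDef), MeasureTheory.IntegrableOn
      (fun t : ℝ => ∑ i, t ^ (p - 1) * logGap t (hM.1.eigenvalues i)) (Set.Ioi 0) :=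
    fun hM => MeasureTheory.integrable_finsetSum _ fun i _ =>
      integrableOn_rpow_mul_logGap hp0 hp2 hp1 (hM.eigenvalues_pos i)
  have hval : ∀ {M : Matrix n n ℂ} (hM : M.PosDef),
      ∫ t in Set.Ioi (0 : ℝ), ∑ i, t ^ (p - 1) * logGap t (hM.1.eigenvalues i) =
        K * ((∑ i, hM.1.eigenvalues i ^ p - ∑ i, ((1 - p) + p * hM.1.eigenvalues i)) /
          (p - 1)) := by
    intro M hM
    rw [MeasureTheory.integral_finsetSum _ fun i _ =>
      integrableOn_rpow_mul_logGap hp0 hp2 hp1 (hM.eigenvalues_pos i), ← sum_sub_distrib,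
      sum_div, mul_sum]
    refine sum_congr rfl fun i _ => ?_
    rw [h _ (hM.eigenvalues_pos i)]
    ring
  have heq : Set.EqOn (fun t : ℝ => ∑ i, t ^ (p - 1) * logGap t (hA.1.eigenvalues i) +
      ∑ i, t ^ (p - 1) * logGap t (hB.1.eigenvalues i) -
      2 * ∑ i, t ^ (p - 1) * logGap t (hC.1.eigenvalues i)) (fun t : ℝ => t ^ (p - 1) *
        stein (A + t • (1 : Matrix n n ℂ)) (B + t • (1 : Matrix n n ℂ))) (Set.Ioi 0) := by
    intro t ht
    simp only [stein_add_smul_one hA hB ht, ← mul_sum]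
    ring
  have hAB : MeasureTheory.IntegrableOn (fun t : ℝ =>
      ∑ i, t ^ (p - 1) * logGap t (hA.1.eigenvalues i) +
        ∑ i, t ^ (p - 1) * logGap t (hB.1.eigenvalues i)) (Set.Ioi 0) := (hitg hA).add (hitg hB)
  have hC2 : MeasureTheory.IntegrableOn (fun t : ℝ =>
      2 * ∑ i, t ^ (p - 1) * logGap t (hC.1.eigenvalues i)) (Set.Ioi 0) := (hitg hC).const_mul 2
  refine ⟨MeasureTheory.IntegrableOn.congr_fun (hAB.sub hC2) heq measurableSet_Ioi, ?_⟩
  rw [← MeasureTheory.setIntegral_congr_fun measurableSet_Ioi heq,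
    MeasureTheory.integral_sub hAB hC2,
    MeasureTheory.integral_add (hitg hA) (hitg hB), MeasureTheory.integral_const_mul,
    hval hA, hval hB, hval hC]
  have haff := sum_affine_eigenvalues_midpoint hA hB (1 - p) p
  have : ∀ a b c a' b' c' : ℝ, a' + b' = 2 * c' →
      K * ((a - a') / (p - 1)) + K * ((b - b') / (p - 1)) - 2 * (K * ((c - c') / (p - 1))) =
        K * ((a + b - 2 * c) / (p - 1)) := by
    intro a b c a' b' c' h
    have : c' = (a' + b') / 2 := by linarith
    rw [this]
    ring
  exact this _ _ _ _ _ _ haff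

theorem trace_sub_mul_self_re {m : Type*} [Fintype m] {A B : Matrix m m ℂ} (hA : A.IsHermitian)
    (hB : B.IsHermitian) :
    ((A - B) * (A - B)).trace.re = ∑ i, ∑ j, ‖(A - B) i j‖ ^ 2 := by
  conv_lhs => enter [1, 1, 2]; rw [← (hA.sub hB).eq]
  simp only [trace, diag_apply, mul_apply, conjTranspose_apply, Complex.re_sum, RCLike.star_def,
    Complex.mul_conj, Complex.ofReal_re, Complex.normSq_eq_norm_sq]

theorem sqrt_sum_norm_sq_sub_triangle {m : Type*} [Fintype m] (A B C : Matrix m m ℂ) :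
    √(∑ i, ∑ j, ‖(A - C) i j‖ ^ 2) ≤
      √(∑ i, ∑ j, ‖(A - B) i j‖ ^ 2) + √(∑ i, ∑ j, ‖(B - C) i j‖ ^ 2) := by
  let _ := frobeniusNormedAddCommGroup (m := m) (n := m) (α := ℂ)
  have h := norm_sub_le_norm_sub_add_norm_sub A B C
  simpa only [frobenius_norm_def, ← Real.sqrt_eq_rpow, Real.rpow_two] using h

end FunctionalCalculus

variable {d : ℕ} {X Y : Matrix (Fin d) (Fin d) ℂ}

theorem mpow_eq_cfc (hX : X.IsHermitian) (r : ℝ) : mpow X r = hX.cfc (fun x => x ^ r) :=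
  dif_pos hX

theorem posDef_mpow (hX : X.PosDef) (r : ℝ) : (mpow X r).PosDef := by
  rw [mpow_eq_cfc hX.1]
  exact posDef_cfc hX fun x hx => Real.rpow_pos_of_pos hx r

theorem mpow_mpow (hX : X.PosDef) (r s : ℝ) : mpow (mpow X r) s = mpow X (r * s) := by
  have h := (posDef_mpow hX r).1
  simp only [mpow_eq_cfc hX.1] at h ⊢
  rw [mpow_eq_cfc h, cfc_cfc]
  exact cfc_congr_pos hX fun x hx => (Real.rpow_mul hx.le r s).symm

theorem mpow_mul_mpow (hX : X.PosDef) (r s : ℝ) : mpow X r * mpow X s = mpow X (r + s) := by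
  simp only [mpow_eq_cfc hX.1, cfc_mul_cfc]
  exact cfc_congr_pos hX fun x hx => (Real.rpow_add hx r s).symm

theorem mpow_one (hX : X.PosDef) : mpow X 1 = X := by
  simp only [mpow_eq_cfc hX.1, Real.rpow_one, cfc_self]

theorem mpow_two (hX : X.PosDef) : mpow X 2 = X * X := by
  rw [← one_add_one_eq_two, ← mpow_mul_mpow hX, mpow_one hX]

theorem trace_mpow (hX : X.PosDef) (r : ℝ) :
    (mpow X r).trace.re = ∑ i, hX.1.eigenvalues i ^ r := by
  rw [mpow_eq_cfc hX.1, trace_cfc]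

theorem mpow_mpow_inv (hX : X.PosDef) {r : ℝ} (hr : r ≠ 0) : mpow (mpow X r) (1 / r) = X := by
  rw [mpow_mpow hX, mul_one_div_cancel hr, mpow_one hX]

theorem mpow_injective (hX : X.PosDef) (hY : Y.PosDef) {r : ℝ} (hr : r ≠ 0)
    (h : mpow X r = mpow Y r) : X = Y := by
  rw [← mpow_mpow_inv hX hr, ← mpow_mpow_inv hY hr, h]

theorem jsTsallis_eq (hX : X.PosDef) (hY : Y.PosDef) {α : ℝ} (hα0 : α ≠ 0) (hα1 : α ≠ 1) :
    jsTsallis α X Y = ((mpow (mpow X α) (1 / α)).trace.re + (mpow (mpow Y α) (1 / α)).trace.re -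
      2 * (mpow ((1 / 2 : ℝ) • (mpow X α + mpow Y α)) (1 / α)).trace.re) / (1 / α - 1) := by
  have hC := posDef_midpoint (posDef_mpow hX α) (posDef_mpow hY α)
  rw [mpow_mpow_inv hX hα0, mpow_mpow_inv hY hα0]
  unfold jsTsallis tsallisRel powerMean
  rw [mpow_mpow hC]
  generalize hA : mpow X α = A at *
  generalize hB : mpow Y α = B at *
  have hN : (A * mpow ((1 / 2 : ℝ) • (A + B)) (1 / α * (1 - α))).trace.re +
      (B * mpow ((1 / 2 : ℝ) • (A + B)) (1 / α * (1 - α))).trace.re =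
      2 * (mpow ((1 / 2 : ℝ) • (A + B)) (1 / α)).trace.re := by
    have h := mpow_mul_mpow hC 1 (1 / α * (1 - α))
    have hexp : 1 + 1 / α * (1 - α) = 1 / α := by
      field_simp
      ring
    rw [hexp, mpow_one hC] at h
    rw [← h, ← Complex.add_re, ← trace_add, ← add_mul]
    simp only [smul_mul_assoc, trace_smul, Complex.smul_re, smul_eq_mul]
    ring
  have h1 : 1 - α ≠ 0 := sub_ne_zero.2 hα1.symm
  have h2 : 1 / α - 1 ≠ 0 := by
    rw [div_sub_one hα0]
    exact div_ne_zero h1 hα0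
  have hN' := eq_sub_of_add_eq hN
  rw [hN']
  field_simp
  ring

theorem jsTsallis_comm (α : ℝ) (X Y : Matrix (Fin d) (Fin d) ℂ) :
    jsTsallis α X Y = jsTsallis α Y X := by
  unfold jsTsallis powerMean
  rw [add_comm (mpow X α), add_comm]

theorem jsTsallis_half (hX : X.PosDef) (hY : Y.PosDef) :
    jsTsallis (1 / 2) X Y =
      1 / 2 * ∑ i, ∑ j, ‖(mpow X (1 / 2) - mpow Y (1 / 2)) i j‖ ^ 2 := by
  have hA := posDef_mpow hX (1 / 2)
  have hB := posDef_mpow hY (1 / 2)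
  rw [jsTsallis_eq hX hY (by norm_num) (by norm_num), ← trace_sub_mul_self_re hA.1 hB.1,
    one_div_one_div, mpow_two hA, mpow_two hB, mpow_two (posDef_midpoint hA hB)]
  simp only [smul_mul_assoc, mul_smul_comm, mul_add, add_mul, mul_sub, sub_mul, trace_smul,
    trace_add, trace_sub, Complex.smul_re, Complex.add_re, Complex.sub_re, smul_eq_mul,
    trace_mul_comm (mpow Y (1 / 2)) (mpow X (1 / 2))]
  ring

theorem exists_integral_eq_mul_jsTsallis {α : ℝ} (hα : 1 / 2 < α) (hα1 : α ≠ 1) :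
    ∃ K : ℝ, 0 < K ∧ ∀ X Y : Matrix (Fin d) (Fin d) ℂ, X.PosDef → Y.PosDef →
      MeasureTheory.IntegrableOn (fun t : ℝ => t ^ (1 / α - 1) *
        stein (mpow X α + t • 1) (mpow Y α + t • 1)) (Set.Ioi 0) ∧
      ∫ t in Set.Ioi (0 : ℝ), t ^ (1 / α - 1) *
        stein (mpow X α + t • 1) (mpow Y α + t • 1) = K * jsTsallis α X Y := by
  have hα0 : 0 < α := by linarith
  obtain ⟨K, hK, h⟩ := exists_integral_rpow_mul_stein_eq (n := Fin d) (p := 1 / α)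
    (by positivity) (by rw [div_lt_iff₀ hα0]; linarith) (by simpa using hα1)
  refine ⟨K, hK, fun X Y hX hY => ?_⟩
  have hA := posDef_mpow hX α
  have hB := posDef_mpow hY α
  rw [jsTsallis_eq hX hY hα0.ne' hα1, trace_mpow hA, trace_mpow hB,
    trace_mpow (posDef_midpoint hA hB)]
  exact h _ _ hA hB

theorem rpow_mul_stein_nonneg (hX : X.PosDef) (hY : Y.PosDef) (α p : ℝ) {t : ℝ} (ht : 0 < t) :
    0 ≤ t ^ p * stein (mpow X α + t • 1) (mpow Y α + t • 1) :=
  mul_nonneg (Real.rpow_nonneg ht.le p) (stein_nonneg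
    (posDef_add_smul_one (posDef_mpow hX α) ht) (posDef_add_smul_one (posDef_mpow hY α) ht))

end TsallisDivergence

/-- For `α ∈ [1/2,∞)\{1}`, `√(Δ_α)` is a metric on `ℙ_d`. -/
theorem jsTsallis_sqrt_metric {d : ℕ} (α : ℝ) (hα : (1 / 2 : ℝ) ≤ α) (hα1 : α ≠ 1)
    (X Y Z : Matrix (Fin d) (Fin d) ℂ) (hX : X.PosDef) (hY : Y.PosDef) (hZ : Z.PosDef) :
    0 ≤ jsTsallis α X Y ∧
    (jsTsallis α X Y = 0 ↔ X = Y) ∧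
    jsTsallis α X Y = jsTsallis α Y X ∧
    Real.sqrt (jsTsallis α X Z) ≤
      Real.sqrt (jsTsallis α X Y) + Real.sqrt (jsTsallis α Y Z) := by
  rcases hα.eq_or_lt with rfl | hα
  · refine ⟨?_, ⟨fun h => ?_, ?_⟩, jsTsallis_comm _ X Y, ?_⟩
    · rw [jsTsallis_half hX hY]
      positivity
    · rw [jsTsallis_half hX hY, mul_eq_zero, or_iff_right one_half_pos.ne',
        Finset.sum_eq_zero_iff_of_nonneg fun i _ => by positivity] at h
      refine mpow_injective hX hY one_half_pos.ne' (sub_eq_zero.1 ?_)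
      ext i j
      have hi := h i (Finset.mem_univ i)
      rw [Finset.sum_eq_zero_iff_of_nonneg fun _ _ => sq_nonneg _] at hi
      simpa using hi j (Finset.mem_univ j)
    · rintro rfl
      rw [jsTsallis_half hX hX]
      simp
    · rw [jsTsallis_half hX hY, jsTsallis_half hX hZ, jsTsallis_half hY hZ]
      simp only [Real.sqrt_mul (show (0 : ℝ) ≤ 1 / 2 by norm_num), ← mul_add]
      exact mul_le_mul_of_nonneg_left (sqrt_sum_norm_sq_sub_triangle _ _ _) (Real.sqrt_nonneg _)
  obtain ⟨K, hK, h⟩ := exists_integral_eq_mul_jsTsallis (d := d) hα hα1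
  have hα0 : α ≠ 0 := by linarith
  have hnn : ∀ {V W : Matrix (Fin d) (Fin d) ℂ}, V.PosDef → W.PosDef → ∀ t ∈ Set.Ioi (0 : ℝ),
      0 ≤ t ^ (1 / α - 1) * stein (mpow V α + t • 1) (mpow W α + t • 1) :=
    fun hV hW t ht => rpow_mul_stein_nonneg hV hW α _ ht
  refine ⟨?_, ⟨fun h0 => ?_, ?_⟩, jsTsallis_comm _ X Y, ?_⟩
  · refine nonneg_of_mul_nonneg_right ?_ hK
    rw [← (h X Y hX hY).2]
    exact MeasureTheory.setIntegral_nonneg measurableSet_Ioi (hnn hX hY)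
  · obtain ⟨hitg, hval⟩ := h X Y hX hY
    rw [h0, mul_zero, MeasureTheory.setIntegral_eq_zero_iff_of_nonneg_ae
      ((MeasureTheory.ae_restrict_iff' measurableSet_Ioi).2 (.of_forall (hnn hX hY))) hitg] at hval
    have : (MeasureTheory.ae (MeasureTheory.volume.restrict (Set.Ioi (0 : ℝ)))).NeBot := by
      rw [MeasureTheory.ae_neBot, Ne, MeasureTheory.Measure.restrict_eq_zero]
      simp
    obtain ⟨t, ht, ht0⟩ :=
      (hval.and (MeasureTheory.ae_restrict_mem measurableSet_Ioi)).exists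
    have hs := (mul_eq_zero.1 ht).resolve_left (Real.rpow_pos_of_pos ht0 _).ne'
    exact mpow_injective hX hY hα0 (add_right_cancel (eq_of_stein_eq_zero
      (posDef_add_smul_one (posDef_mpow hX α) ht0)
      (posDef_add_smul_one (posDef_mpow hY α) ht0) hs))
  · rintro rfl
    have := (h X X hX hX).2
    simp only [stein_self, mul_zero, MeasureTheory.integral_zero] at this
    exact (mul_eq_zero.1 this.symm).resolve_left hK.ne'
  · have htri := sqrt_integral_triangle measurableSet_Ioi (hnn hX hZ) (hnn hX hY) (hnn hY hZ)
      (h X Z hX hZ).1 (h X Y hX hY).1 (h Y Z hY hZ).1 fun t ht => by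
        have ht' := Real.rpow_nonneg (le_of_lt ht) (1 / α - 1)
        rw [Real.sqrt_mul ht', Real.sqrt_mul ht', Real.sqrt_mul ht', ← mul_add]
        exact mul_le_mul_of_nonneg_left (sqrt_stein_triangle
          (posDef_add_smul_one (posDef_mpow hX α) ht) (posDef_add_smul_one (posDef_mpow hY α) ht)
          (posDef_add_smul_one (posDef_mpow hZ α) ht)) (Real.sqrt_nonneg _)
    rw [(h X Z hX hZ).2, (h X Y hX hY).2, (h Y Z hY hZ).2, Real.sqrt_mul hK.le,
      Real.sqrt_mul hK.le, Real.sqrt_mul hK.le, ← mul_add] at htri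
    exact le_of_mul_le_mul_left htri (Real.sqrt_pos.2 hK)
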